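/- For the posterior-variance cost φ(x) = κ(x - μ_L)², the first-order condition 0 = φ(b) + (a_L - b)φ'(b) + v - φ(a_L) has the unique solution b = a_L - √(v/κ), and the associated probability of reaching the high posterior is p_L = (μ_L - b)/(a_L - b) = (μ_L + d - a_L)/d where d := √(v/κ), provided a_L - d < μ_L < a_L. -/

import Mathlib

open Set

theorem stmt18 (κ v μL aL : ℝ) (hκ : 0 < κ) (hv : 0 < v)
    (hdaL : Real.sqrt (v / κ) < aL) (haL1 : aL < 1)
    (hlo : aL - Real.sqrt (v / κ) < μL) (hhi : μL < aL) :
    (∀ b : ℝ, b < aL →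
      (κ * (b - μL) ^ 2 + (aL - b) * (2 * κ * (b - μL)) + v - κ * (aL - μL) ^ 2 = 0 ↔
        b = aL - Real.sqrt (v / κ))) ∧
    (μL - (aL - Real.sqrt (v / κ))) / (aL - (aL - Real.sqrt (v / κ))) =
      (μL + Real.sqrt (v / κ) - aL) / Real.sqrt (v / κ) := by
  have hd : 0 < Real.sqrt (v / κ) := Real.sqrt_pos.mpr (div_pos hv hκ)
  have hsq : κ * Real.sqrt (v / κ) ^ 2 = v := by
    rw [Real.sq_sqrt (div_pos hv hκ).le, mul_div_cancel₀ v hκ.ne']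
  generalize Real.sqrt (v / κ) = d at *
  refine ⟨fun b hb => ⟨fun h => ?_, fun h => ?_⟩, by congr 1 <;> ring⟩
  · have hsq' : (aL - b) ^ 2 = d ^ 2 :=
      mul_left_cancel₀ hκ.ne' (by linear_combination -h - hsq)
    have := (sq_eq_sq₀ (sub_pos.mpr hb).le hd.le).mp hsq'
    linarith
  · subst h
    linear_combination -hsq
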